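/- arXiv:2502.20987 — 2 statements merged into one kernel-verified Lean document; each statement's English description precedes it below -/
import Mathlib

section
/- Let Δ be a simplicial complex on V = {0,1,…,r}, q ≥ 1 an integer, and k a field. Then the Stanley–Reisner ideal I(σ_qΔ) ⊆ k[x_0,…,x_r] is generated by its homogeneous elements of degree q+1 if and only if there exists an F_{q,1}-free finite simple graph G on the vertex set V such that σ_qΔ = σ_qΔ(G), where Δ(G) is the clique complex of G. -/
open SimpleGraph Finset

/-- A simplicial complex on the vertex type `V`: closed under subsets and
containing every singleton. -/
def IsComplex {V : Type*} (Δ : Set (Finset V)) : Prop :=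
  (∀ F ∈ Δ, ∀ G : Finset V, G ⊆ F → G ∈ Δ) ∧ (∀ v : V, ({v} : Finset V) ∈ Δ)

/-- The `q`-secant complex `σ_q Δ`: its faces are unions of `q` faces of `Δ`. -/
def secant {V : Type*} [DecidableEq V] (q : ℕ) (Δ : Set (Finset V)) : Set (Finset V) :=
  {F | ∃ f : Fin q → Finset V, (∀ i, f i ∈ Δ) ∧ F = Finset.univ.sup f}

/-- Clique complex of a graph. -/
def cliqueComplex {V : Type*} (G : SimpleGraph V) : Set (Finset V) :=
  {F | G.IsClique (F : Set V)}

/-- `S` is a union of `q` cliques of `G`. -/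
def CliqueCoverable {V : Type*} (G : SimpleGraph V) (q : ℕ) (S : Set V) : Prop :=
  ∃ f : Fin q → Set V, (∀ i, G.IsClique (f i)) ∧ S = ⋃ i, f i

/-- Membership in the family `𝓕_{q,1}`: `H` is not the edgeless graph on `q+1`
vertices, its vertex set is not a union of `q` cliques, but every proper subset is. -/
def MemF1 {V : Type*} [Fintype V] (q : ℕ) (H : SimpleGraph V) : Prop :=
  ¬(Fintype.card V = q + 1 ∧ H = ⊥) ∧
  ¬CliqueCoverable H q Set.univ ∧
  ∀ S : Set V, S ≠ Set.univ → CliqueCoverable H q S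

/-- `𝓕_{q,1}`-freeness: no induced subgraph belongs to `𝓕_{q,1}`. -/
def F1Free {V : Type*} [Fintype V] [DecidableEq V] (q : ℕ) (G : SimpleGraph V) : Prop :=
  ∀ S : Finset V, ¬MemF1 q (G.induce (S : Set V))

/-- Elementary bipartite graph: a bipartite graph such that removing any vertex from
each side leaves a graph with a perfect matching. -/
def ElemBipartite {V : Type*} (H : SimpleGraph V) : Prop :=
  ∃ U W : Set V, Disjoint U W ∧ U ∪ W = Set.univ ∧
    (∀ a b, H.Adj a b → (a ∈ U ∧ b ∈ W) ∨ (a ∈ W ∧ b ∈ U)) ∧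
    ∀ u ∈ U, ∀ w ∈ W, ∃ M : H.Subgraph, M.verts = Set.univ \ {u, w} ∧ M.IsMatching

/-- Membership in the family `𝓕_{q,2}`: a disjoint union of an elementary bipartite
graph on `2j+2` vertices (1 ≤ j ≤ q) with `q - j` isolated vertices. -/
def MemF2 {V : Type*} [Fintype V] [DecidableEq V] (q : ℕ) (G : SimpleGraph V) : Prop :=
  ∃ j : ℕ, 1 ≤ j ∧ j ≤ q ∧ ∃ S : Finset V,
    S.card = 2 * j + 2 ∧ Fintype.card V = (2 * j + 2) + (q - j) ∧
    (∀ a b, G.Adj a b → a ∈ S ∧ b ∈ S) ∧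
    ElemBipartite (G.induce (S : Set V))

/-- `𝓕_{q,2}`-freeness. -/
def F2Free {V : Type*} [Fintype V] [DecidableEq V] (q : ℕ) (G : SimpleGraph V) : Prop :=
  ∀ S : Finset V, ¬MemF2 q (G.induce (S : Set V))

/-- `G` has no induced cycle `C_n`. -/
def CycleFree {V : Type*} [Fintype V] [DecidableEq V] (G : SimpleGraph V) (n : ℕ) : Prop :=
  ∀ S : Finset V, IsEmpty (G.induce (S : Set V) ≃g cycleGraph n)

/-- `q`-secant chordality: `𝓕_{q,1}`-free, `𝓕_{q,2}`-free and `C_{2q+p}`-free for all `p ≥ 3`. -/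
def SecantChordal {V : Type*} [Fintype V] [DecidableEq V] (q : ℕ) (G : SimpleGraph V) : Prop :=
  F1Free q G ∧ F2Free q G ∧ ∀ p : ℕ, 3 ≤ p → CycleFree G (2 * q + p)

/-- Edge contraction `G/e` where `e = {u, v}`: the vertex `u` is removed and `v` plays
the role of the new identified vertex `z`, which is adjacent to every vertex adjacent
in `G` to `u` or to `v`; other adjacencies are unchanged. -/
def contractEdge {V : Type*} (G : SimpleGraph V) (u v : V) :
    SimpleGraph {a : V // a ≠ u} :=
  SimpleGraph.fromRel (fun a b =>
    G.Adj a.1 b.1 ∨ (a.1 = v ∧ G.Adj u b.1) ∨ (b.1 = v ∧ G.Adj a.1 u))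

/-- Independent set: a set of pairwise nonadjacent vertices. -/
def IsIndepSet {V : Type*} (G : SimpleGraph V) (S : Set V) : Prop :=
  ∀ a ∈ S, ∀ b ∈ S, a ≠ b → ¬G.Adj a b

/-- The Stanley–Reisner ideal of a simplicial complex `Δ` on `V`: generated by the
squarefree monomials indexed by the non-faces of `Δ`. -/
noncomputable def stanleyReisnerIdeal (k : Type*) [Field k] {V : Type*} [DecidableEq V]
    (Δ : Set (Finset V)) : Ideal (MvPolynomial V k) :=
  Ideal.span {m | ∃ W : Finset V, W ∉ Δ ∧ m = ∏ i ∈ W, MvPolynomial.X i}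

theorem isComplex_cliqueComplex {V : Type*} (G : SimpleGraph V) : IsComplex (cliqueComplex G) := by
  refine ⟨fun F hF H hHF => ?_, fun v => ?_⟩
  · exact Set.Pairwise.mono (by exact_mod_cast hHF) hF
  · simp [cliqueComplex]

/-- A finite set is a face of the `q`-secant complex iff it can be coloured with `q` colours
such that every colour class is a face. -/
theorem mem_secant_iff_exists_coloring {V : Type*} [DecidableEq V] {q : ℕ} (hq : 1 ≤ q)
    {Δ : Set (Finset V)} (hΔ : IsComplex Δ) {F : Finset V} :
    F ∈ secant q Δ ↔ ∃ c : V → Fin q, ∀ i, {v ∈ F | c v = i} ∈ Δ := by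
  constructor
  · rintro ⟨f, hf, rfl⟩
    have h : ∀ v : V, ∃ i : Fin q, v ∈ univ.sup f → v ∈ f i := by
      intro v
      by_cases hv : v ∈ univ.sup f
      · obtain ⟨i, -, hi⟩ := Finset.mem_sup.1 hv
        exact ⟨i, fun _ => hi⟩
      · exact ⟨⟨0, hq⟩, fun h => absurd h hv⟩
    choose c hc using h
    refine ⟨c, fun i => hΔ.1 (f i) (hf i) _ fun v hv => ?_⟩
    obtain ⟨hvF, rfl⟩ := Finset.mem_filter.1 hv
    exact hc v hvF
  · rintro ⟨c, hc⟩
    refine ⟨_, hc, ?_⟩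
    ext v
    simp [Finset.mem_sup]

theorem secant_mono {V : Type*} [DecidableEq V] (q : ℕ) {Δ Δ' : Set (Finset V)} (h : Δ ⊆ Δ') :
    secant q Δ ⊆ secant q Δ' :=
  fun _ ⟨f, hf, hF⟩ => ⟨f, fun i => h (hf i), hF⟩

theorem mem_secant_of_subset {V : Type*} [DecidableEq V] {q : ℕ} {Δ : Set (Finset V)}
    (hΔ : IsComplex Δ) {F H : Finset V} (hF : F ∈ secant q Δ) (hHF : H ⊆ F) :
    H ∈ secant q Δ := by
  obtain ⟨f, hf, rfl⟩ := hF
  refine ⟨fun i => f i ∩ H, fun i => hΔ.1 _ (hf i) _ inter_subset_left, ?_⟩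
  ext v
  have := @hHF v
  simp only [Finset.mem_sup, Finset.mem_inter] at this ⊢
  grind

theorem exists_injOn_fin_of_card_le {V : Type*} [DecidableEq V] {q : ℕ} (hq : 1 ≤ q)
    {F : Finset V} (hF : #F ≤ q) : ∃ c : V → Fin q, Set.InjOn c F := by
  refine ⟨fun v => if h : v ∈ F then Fin.castLE hF (F.equivFin ⟨v, h⟩) else ⟨0, hq⟩, ?_⟩
  intro v hv w hw h
  simpa [Finset.mem_coe.1 hv, Finset.mem_coe.1 hw] using h

theorem mem_of_card_le_one {V : Type*} [Nonempty V] {Δ : Set (Finset V)} (hΔ : IsComplex Δ)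
    {F : Finset V} (hF : #F ≤ 1) : F ∈ Δ := by
  obtain ⟨v, hv⟩ := Finset.card_le_one_iff_subset_singleton.1 hF
  exact hΔ.1 _ (hΔ.2 v) _ hv

theorem mem_secant_of_card_le {V : Type*} [DecidableEq V] [Nonempty V] {q : ℕ} (hq : 1 ≤ q)
    {Δ : Set (Finset V)} (hΔ : IsComplex Δ) {F : Finset V} (hF : #F ≤ q) :
    F ∈ secant q Δ := by
  obtain ⟨c, hc⟩ := exists_injOn_fin_of_card_le hq hF
  refine (mem_secant_iff_exists_coloring hq hΔ).2 ⟨c, fun i => mem_of_card_le_one hΔ ?_⟩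
  refine Finset.card_le_one.2 fun a ha b hb => ?_
  simp only [Finset.mem_filter] at ha hb
  exact hc ha.1 hb.1 (ha.2.trans hb.2.symm)

theorem mem_secant_of_pair_mem {V : Type*} [DecidableEq V] [Nonempty V] {q : ℕ} (hq : 1 ≤ q)
    {Δ : Set (Finset V)} (hΔ : IsComplex Δ) {F : Finset V} (hF : #F = q + 1) {a b : V}
    (ha : a ∈ F) (hb : b ∈ F) (hab : a ≠ b) (h : {a, b} ∈ Δ) : F ∈ secant q Δ := by
  obtain ⟨c, hc⟩ := exists_injOn_fin_of_card_le hq (F := F.erase a)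
    (by rw [Finset.card_erase_of_mem ha]; lia)
  have hc' : ∀ v ∈ F, ∀ w ∈ F, v ≠ a → w ≠ a → c v = c w → v = w := fun v hv w hw hva hwa hvw =>
    hc (by simp [hv, hva]) (by simp [hw, hwa]) hvw
  refine (mem_secant_iff_exists_coloring hq hΔ).2 ⟨Function.update c a (c b), fun i => ?_⟩
  by_cases hi : i = c b
  · refine hΔ.1 _ h _ fun v hv => ?_
    simp only [Finset.mem_filter, Function.update_apply] at hv
    simp only [Finset.mem_insert, Finset.mem_singleton]
    grind
  · refine mem_of_card_le_one hΔ (Finset.card_le_one.2 fun v hv w hw => ?_)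
    simp only [Finset.mem_filter, Function.update_apply] at hv hw
    grind

theorem exists_pair_of_mem_secant_cliqueComplex {V : Type*} [DecidableEq V] {q : ℕ} (hq : 1 ≤ q)
    {G : SimpleGraph V} {F : Finset V} (hF : q < #F) (h : F ∈ secant q (cliqueComplex G)) :
    ∃ a ∈ F, ∃ b ∈ F, G.Adj a b := by
  obtain ⟨c, hc⟩ := (mem_secant_iff_exists_coloring hq (isComplex_cliqueComplex G)).1 h
  obtain ⟨a, ha, b, hb, hab, h⟩ := Finset.exists_ne_map_eq_of_card_lt_of_maps_to
    (t := (univ : Finset (Fin q))) (f := c) (by simpa using hF) (fun _ _ => by simp)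
  exact ⟨a, ha, b, hb, hc (c b) (by simp [ha, h]) (by simp [hb]) hab⟩

theorem cliqueCoverable_coe_iff {V : Type*} [DecidableEq V] [Fintype V] {G : SimpleGraph V}
    {q : ℕ} {F : Finset V} :
    CliqueCoverable G q (F : Set V) ↔ F ∈ secant q (cliqueComplex G) := by
  classical
  constructor
  · rintro ⟨f, hf, hF⟩
    refine ⟨fun i => (f i).toFinset, fun i => by simpa [cliqueComplex] using hf i, ?_⟩
    ext v
    have : v ∈ (F : Set V) ↔ v ∈ ⋃ i, f i := by rw [hF]
    simpa [Finset.mem_sup] using this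
  · rintro ⟨f, hf, rfl⟩
    refine ⟨fun i => f i, hf, ?_⟩
    ext v
    simp [Finset.mem_sup]

theorem cliqueCoverable_induce_iff {V : Type*} {G : SimpleGraph V} {q : ℕ} {S : Set V}
    {T : Set S} : CliqueCoverable (G.induce S) q T ↔ CliqueCoverable G q (Subtype.val '' T) := by
  constructor
  · rintro ⟨f, hf, rfl⟩
    refine ⟨fun i => Subtype.val '' f i, fun i => ?_, Set.image_iUnion⟩
    rintro _ ⟨a, ha, rfl⟩ _ ⟨b, hb, rfl⟩ hab
    exact hf i ha hb fun h => hab (congrArg _ h)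
  · rintro ⟨f, hf, hT⟩
    refine ⟨fun i => Subtype.val ⁻¹' f i, fun i a ha b hb hab => ?_, ?_⟩
    · exact hf i ha hb fun h => hab (Subtype.ext h)
    · rw [← Set.preimage_iUnion, ← hT, Set.preimage_image_eq _ Subtype.val_injective]

/-- The induced subgraphs in `𝓕_{q,1}` are the minimal nonfaces of the `q`-secant complex of the
clique complex, apart from the independent sets of size `q + 1`. -/
theorem memF1_induce_iff {V : Type*} [DecidableEq V] [Fintype V] {G : SimpleGraph V}
    {q : ℕ} {S : Finset V} :
    MemF1 q (G.induce (S : Set V)) ↔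
      ¬(#S = q + 1 ∧ ∀ a ∈ S, ∀ b ∈ S, ¬G.Adj a b) ∧ S ∉ secant q (cliqueComplex G) ∧
        ∀ T, T ⊂ S → T ∈ secant q (cliqueComplex G) := by
  have hbot : G.induce (S : Set V) = ⊥ ↔ ∀ a ∈ S, ∀ b ∈ S, ¬G.Adj a b := by
    constructor
    · intro h a ha b hb hab
      have : (G.induce (S : Set V)).Adj ⟨a, ha⟩ ⟨b, hb⟩ := hab
      rw [h] at this
      exact this
    · intro h
      ext a b
      simpa using h a a.2 b b.2
  have hproper : (∀ T : Set (S : Set V), T ≠ Set.univ → CliqueCoverable (G.induce (S : Set V)) q T) ↔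
      ∀ T, T ⊂ S → T ∈ secant q (cliqueComplex G) := by
    classical
    constructor
    · intro h T hT
      have := h (Subtype.val ⁻¹' (T : Set V)) fun hu => hT.2 fun a ha => by
        have : (⟨a, ha⟩ : (S : Set V)) ∈ (Subtype.val ⁻¹' (T : Set V) : Set (S : Set V)) :=
          hu ▸ Set.mem_univ _
        exact this
      rwa [cliqueCoverable_induce_iff, Subtype.image_preimage_coe,
        Set.inter_eq_right.2 (by exact_mod_cast hT.1), cliqueCoverable_coe_iff] at this
    · intro h T hT
      rw [cliqueCoverable_induce_iff, ← Set.coe_toFinset (Subtype.val '' T),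
        cliqueCoverable_coe_iff]
      refine h _ ⟨fun a ha => ?_, fun hS => hT (Set.eq_univ_of_forall fun a => ?_)⟩
      · obtain ⟨b, -, rfl⟩ := Set.mem_toFinset.1 ha
        exact b.2
      · obtain ⟨b, hb, hba⟩ := Set.mem_toFinset.1 (hS a.2)
        exact Subtype.ext hba ▸ hb
  rw [MemF1, hproper, hbot, cliqueCoverable_induce_iff, Set.image_univ, Subtype.range_coe,
    cliqueCoverable_coe_iff]
  simp

theorem f1Free_iff {V : Type*} [DecidableEq V] [Fintype V] [Nonempty V] {G : SimpleGraph V}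
    {q : ℕ} (hq : 1 ≤ q) :
    F1Free q G ↔ ∀ W ∉ secant q (cliqueComplex G),
      ∃ U ⊆ W, U ∉ secant q (cliqueComplex G) ∧ #U = q + 1 := by
  simp only [F1Free, memF1_induce_iff]
  constructor
  · intro h W hW
    obtain ⟨U, hUW, hU⟩ := exists_minimal_le_of_wellFoundedLT
      (fun U => U ∉ secant q (cliqueComplex G)) W hW
    refine ⟨U, hUW, hU.1, ?_⟩
    by_contra hcard
    exact h U ⟨fun h' => hcard h'.1, hU.1, fun T hT => not_not.1 fun hT' => hT.2 (hU.2 hT' hT.1)⟩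
  · rintro h S ⟨h1, h2, h3⟩
    obtain ⟨U, hUS, hU, hcard⟩ := h S h2
    obtain rfl : U = S := by
      by_contra hne
      exact hU (h3 U (hUS.ssubset_of_ne hne))
    refine h1 ⟨hcard, fun a ha b hb hab => h2 ?_⟩
    refine mem_secant_of_pair_mem hq (isComplex_cliqueComplex G) hcard ha hb hab.ne ?_
    simp [cliqueComplex, SimpleGraph.isClique_iff, hab]

theorem mem_stanleyReisnerIdeal_iff {k : Type*} [Field k] {V : Type*} [DecidableEq V]
    {Δ : Set (Finset V)} {f : MvPolynomial V k} :
    f ∈ stanleyReisnerIdeal k Δ ↔ ∀ m ∈ f.support, ∃ W ∉ Δ, W ⊆ m.support := by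
  have hgen : {m : MvPolynomial V k | ∃ W : Finset V, W ∉ Δ ∧ m = ∏ i ∈ W, MvPolynomial.X i} =
      (fun s => MvPolynomial.monomial s (1 : k)) ''
        ((fun W : Finset V => ∑ i ∈ W, Finsupp.single i 1) '' Δᶜ) := by
    rw [Set.image_image]
    ext m
    simp [MvPolynomial.monomial_sum_one, MvPolynomial.X, eq_comm]
  rw [stanleyReisnerIdeal, hgen, MvPolynomial.mem_ideal_span_monomial_image]
  have hle : ∀ (W : Finset V) (m : V →₀ ℕ),
      ∑ i ∈ W, Finsupp.single i 1 ≤ m ↔ W ⊆ m.support := by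
    intro W m
    simp only [Finsupp.le_def, Finsupp.finsetSum_apply, Finsupp.single_apply,
      Finset.sum_ite_eq', Finset.subset_iff, Finsupp.mem_support_iff]
    refine forall_congr' fun v => ?_
    split_ifs with h <;> simp [h, Nat.one_le_iff_ne_zero]
  simp [hle]

theorem prod_X_mem_stanleyReisnerIdeal_iff {k : Type*} [Field k] {V : Type*} [DecidableEq V]
    {Δ : Set (Finset V)} {W : Finset V} :
    ∏ i ∈ W, (MvPolynomial.X i : MvPolynomial V k) ∈ stanleyReisnerIdeal k Δ ↔
      ∃ U ∉ Δ, U ⊆ W := by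
  have hprod : ∏ i ∈ W, (MvPolynomial.X i : MvPolynomial V k) =
      MvPolynomial.monomial (∑ i ∈ W, Finsupp.single i 1) 1 := by
    simp [MvPolynomial.monomial_sum_one, MvPolynomial.X]
  have hsupp : (∑ i ∈ W, Finsupp.single i 1 : V →₀ ℕ).support = W := by
    ext v
    simp [Finsupp.finsetSum_apply, Finsupp.single_apply]
  classical
  rw [hprod, mem_stanleyReisnerIdeal_iff, MvPolynomial.support_monomial, if_neg one_ne_zero]
  simp [hsupp]

/-- If every nonface has at least `d` elements, the Stanley–Reisner ideal is generated in
degree `d` iff every nonface contains a nonface of size `d`. -/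
theorem stanleyReisnerIdeal_eq_span_isHomogeneous_iff {k : Type*} [Field k] {V : Type*}
    [DecidableEq V] {Δ : Set (Finset V)} {d : ℕ} (hd : ∀ W ∉ Δ, d ≤ #W) :
    stanleyReisnerIdeal k Δ =
        Ideal.span {f : MvPolynomial V k | f ∈ stanleyReisnerIdeal k Δ ∧ f.IsHomogeneous d} ↔
      ∀ W ∉ Δ, ∃ U ⊆ W, U ∉ Δ ∧ #U = d := by
  constructor
  · intro h W hW
    have hle : stanleyReisnerIdeal k Δ ≤ stanleyReisnerIdeal k {U | U ∉ Δ → #U ≠ d} := by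
      rw [h, Ideal.span_le]
      rintro f ⟨hf, hfd⟩
      refine mem_stanleyReisnerIdeal_iff.2 fun m hm => ?_
      obtain ⟨U, hU, hUm⟩ := mem_stanleyReisnerIdeal_iff.1 hf m hm
      refine ⟨U, fun h => h hU (le_antisymm ?_ (hd U hU)), hUm⟩
      have hdeg : m.degree = d := by
        rw [Finsupp.degree_eq_weight_one]
        exact hfd (MvPolynomial.mem_support_iff.1 hm)
      calc #U ≤ #m.support := Finset.card_le_card hUm
        _ = ∑ _i ∈ m.support, 1 := by simp
        _ ≤ m.degree := Finset.sum_le_sum fun i hi =>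
          Nat.one_le_iff_ne_zero.2 (Finsupp.mem_support_iff.1 hi)
        _ = d := hdeg
    obtain ⟨U, hU, hUW⟩ := prod_X_mem_stanleyReisnerIdeal_iff.1
      (hle (prod_X_mem_stanleyReisnerIdeal_iff.2 ⟨W, hW, subset_rfl⟩))
    simp only [Set.mem_ofPred_eq, Classical.not_imp, not_not] at hU
    exact ⟨U, hUW, hU⟩
  · intro h
    refine le_antisymm (Ideal.span_le.2 ?_) (Ideal.span_le.2 fun f hf => hf.1)
    rintro _ ⟨W, hW, rfl⟩
    obtain ⟨U, hUW, hU, hcard⟩ := h W hW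
    refine Ideal.mem_of_dvd _ (Finset.prod_dvd_prod_of_subset U W _ hUW) (Ideal.subset_span ⟨?_, ?_⟩)
    · exact prod_X_mem_stanleyReisnerIdeal_iff.2 ⟨U, hU, subset_rfl⟩
    · have := MvPolynomial.IsHomogeneous.prod U (fun i => (MvPolynomial.X i : MvPolynomial V k))
        (fun _ => 1) fun i _ => MvPolynomial.isHomogeneous_X k i
      simpa [hcard] using this

/-- The graph whose edges are the two-element faces of `Δ`. -/
def edgeGraph {V : Type*} [DecidableEq V] (Δ : Set (Finset V)) : SimpleGraph V where
  Adj a b := a ≠ b ∧ {a, b} ∈ Δ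
  symm := ⟨fun a b h => ⟨h.1.symm, Finset.pair_comm a b ▸ h.2⟩⟩
  loopless := ⟨fun _ h => h.1 rfl⟩

theorem subset_cliqueComplex_edgeGraph {V : Type*} [DecidableEq V] {Δ : Set (Finset V)}
    (hΔ : IsComplex Δ) : Δ ⊆ cliqueComplex (edgeGraph Δ) := by
  refine fun F hF a ha b hb hab => ⟨hab, hΔ.1 F hF _ ?_⟩
  simpa [Finset.insert_subset_iff] using And.intro ha hb

theorem secant_eq_secant_cliqueComplex_edgeGraph {V : Type*} [DecidableEq V] [Nonempty V] {q : ℕ}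
    (hq : 1 ≤ q) {Δ : Set (Finset V)} (hΔ : IsComplex Δ)
    (h : ∀ W ∉ secant q Δ, ∃ U ⊆ W, U ∉ secant q Δ ∧ #U = q + 1) :
    secant q Δ = secant q (cliqueComplex (edgeGraph Δ)) := by
  refine (secant_mono q (subset_cliqueComplex_edgeGraph hΔ)).antisymm fun W hW => ?_
  by_contra hW'
  obtain ⟨U, hUW, hU, hcard⟩ := h W hW'
  obtain ⟨a, ha, b, hb, hab, hmem⟩ := exists_pair_of_mem_secant_cliqueComplex hq (by lia)
    (mem_secant_of_subset (isComplex_cliqueComplex _) hW hUW)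
  exact hU (mem_secant_of_pair_mem hq hΔ hcard ha hb hab hmem)

/-- `I(σ_q Δ)` is generated by its homogeneous elements of degree `q+1`
iff `σ_q Δ = σ_q Δ(G)` for some `𝓕_{q,1}`-free graph `G` on the vertex set. -/
theorem stanleyReisner_secant_generated_in_degree_succ_iff
    (k : Type*) [Field k] (r q : ℕ) (hq : 1 ≤ q)
    (Δ : Set (Finset (Fin (r + 1)))) (hΔ : IsComplex Δ) :
    stanleyReisnerIdeal k (secant q Δ) =
        Ideal.span {f : MvPolynomial (Fin (r + 1)) k |
          f ∈ stanleyReisnerIdeal k (secant q Δ) ∧ f.IsHomogeneous (q + 1)} ↔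
      ∃ G : SimpleGraph (Fin (r + 1)), F1Free q G ∧
        secant q Δ = secant q (cliqueComplex G) := by
  rw [stanleyReisnerIdeal_eq_span_isHomogeneous_iff fun W hW =>
    Nat.lt_of_not_ge fun hcard => hW (mem_secant_of_card_le hq hΔ hcard)]
  constructor
  · intro h
    have heq := secant_eq_secant_cliqueComplex_edgeGraph hq hΔ h
    exact ⟨edgeGraph Δ, (f1Free_iff hq).2 (heq ▸ h), heq⟩
  · rintro ⟨G, hG, heq⟩
    rw [heq]
    exact (f1Free_iff hq).1 hG
end

section
/- Let q ≥ 1 and let T₀ be a tree on q+1 vertices. Let T be the graph whose vertex set is the disjoint union V(T₀) ⊔ E(T₀), in which v ∈ V(T₀) is adjacent to e ∈ E(T₀) if and only if v is an endpoint of e, and with no other adjacencies (the subdivision of T₀). Then T is a tree, and the unique independent set of size q+1 in T (a set of q+1 pairwise nonadjacent vertices) is V(T₀). -/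
open SimpleGraph Finset

/-- The subdivision of a graph `T₀`: its vertices are the vertices and the edges of
`T₀`, and `v` is adjacent to `e` iff `v` is an endpoint of `e`. -/
def subdivision {V : Type*} (T₀ : SimpleGraph V) : SimpleGraph (V ⊕ T₀.edgeSet) :=
  SimpleGraph.fromRel (fun x y =>
    ∃ (v : V) (e : T₀.edgeSet), x = Sum.inl v ∧ y = Sum.inr e ∧ v ∈ e.1)

theorem subdivision_adj_inl_inr {V : Type*} {G : SimpleGraph V} {v : V} {e : G.edgeSet} :
    (subdivision G).Adj (Sum.inl v) (Sum.inr e) ↔ v ∈ e.1 := by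
  simp [subdivision]

theorem not_subdivision_adj_inl_inl {V : Type*} {G : SimpleGraph V} {v w : V} :
    ¬(subdivision G).Adj (Sum.inl v) (Sum.inl w) := by
  simp [subdivision]

theorem not_subdivision_adj_inr_inr {V : Type*} {G : SimpleGraph V} {e f : G.edgeSet} :
    ¬(subdivision G).Adj (Sum.inr e) (Sum.inr f) := by
  simp [subdivision]

theorem connected_subdivision {V : Type*} {G : SimpleGraph V} (hG : G.Connected) :
    (subdivision G).Connected := by
  have hwalk {u v : V} (p : G.Walk u v) :
      (subdivision G).Reachable (Sum.inl u) (Sum.inl v) := by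
    induction p with
    | nil => rfl
    | @cons u v w h p ih =>
      have hu : (subdivision G).Adj (Sum.inl u) (Sum.inr ⟨s(u, v), h⟩) :=
        subdivision_adj_inl_inr.2 (Sym2.mem_mk_left u v)
      have hv : (subdivision G).Adj (Sum.inl v) (Sum.inr ⟨s(u, v), h⟩) :=
        subdivision_adj_inl_inr.2 (Sym2.mem_mk_right u v)
      exact hu.reachable.trans (hv.symm.reachable.trans ih)
  obtain ⟨r⟩ := hG.nonempty
  refine (connected_iff_exists_forall_reachable _).2 ⟨Sum.inl r, ?_⟩
  rintro (v | e)
  · exact (hG r v).elim hwalk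
  · have hv : (subdivision G).Adj (Sum.inl e.1.out.1) (Sum.inr e) :=
      subdivision_adj_inl_inr.2 (Sym2.out_fst_mem e.1)
    exact ((hG r e.1.out.1).elim hwalk).trans hv.reachable

theorem card_edgeSet_subdivision_le {V : Type*} [Finite V] (G : SimpleGraph V) :
    Nat.card (subdivision G).edgeSet ≤ 2 * Nat.card G.edgeSet := by
  classical
  have := Fintype.ofFinite V
  have hsub : (subdivision G).edgeSet ⊆
      Set.range fun d : G.Dart ↦ s(Sum.inl d.fst, Sum.inr ⟨d.edge, d.edge_mem⟩) := by
    have key {v : V} {e : G.edgeSet} (h : v ∈ e.1) : ∃ d : G.Dart,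
        s(Sum.inl d.fst, Sum.inr ⟨d.edge, d.edge_mem⟩) =
          s((Sum.inl v : V ⊕ G.edgeSet), Sum.inr e) := by
      obtain ⟨e, he⟩ := e
      obtain ⟨w, rfl⟩ := h
      exact ⟨⟨(v, w), he⟩, rfl⟩
    rintro ⟨v | e, w | f⟩ h
    · exact (not_subdivision_adj_inl_inl h).elim
    · exact key (subdivision_adj_inl_inr.1 h)
    · obtain ⟨d, hd⟩ := key (subdivision_adj_inl_inr.1 h.symm)
      exact ⟨d, hd.trans Sym2.eq_swap⟩
    · exact (not_subdivision_adj_inr_inr h).elim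
  calc Nat.card (subdivision G).edgeSet
      ≤ Nat.card (Set.range fun d : G.Dart ↦
          s((Sum.inl d.fst : V ⊕ G.edgeSet), Sum.inr ⟨d.edge, d.edge_mem⟩)) :=
        Nat.card_mono (Set.toFinite _) hsub
    _ ≤ Nat.card G.Dart := Finite.card_range_le _
    _ = 2 * Nat.card G.edgeSet := by
        rw [Nat.card_eq_fintype_card, Nat.card_eq_fintype_card, G.dart_card_eq_twice_card_edges,
          edgeFinset_card]

theorem isTree_subdivision {V : Type*} [Finite V] {G : SimpleGraph V} (hG : G.IsTree) :
    (subdivision G).IsTree := by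
  have hconn := connected_subdivision hG.connected
  have hcard := (isTree_iff_connected_and_card.1 hG).2
  have hle := card_edgeSet_subdivision_le G
  have hge := hconn.card_vert_le_card_edgeSet_add_one
  refine isTree_iff_connected_and_card.2 ⟨hconn, ?_⟩
  rw [Nat.card_sum] at hge ⊢
  lia

theorem SimpleGraph.IsAcyclic.card_edgeSet_lt {V : Type*} [Finite V] [Nonempty V]
    {G : SimpleGraph V} (hG : G.IsAcyclic) : Nat.card G.edgeSet < Nat.card V := by
  obtain ⟨T, hGT, -, hT⟩ :=
    (connected_top (V := V)).exists_isTree_le_of_le_of_isAcyclic le_top hG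
  have hle := Nat.card_mono (Set.toFinite T.edgeSet) (edgeSet_mono hGT)
  have hcard := (isTree_iff_connected_and_card.1 hT).2
  lia

/-- An independent set of the subdivision of a finite forest that misses an original vertex
is smaller than the set of all original vertices. -/
theorem ncard_lt_of_isIndepSet_subdivision {V : Type*} [Finite V] {G : SimpleGraph V}
    (hG : G.IsAcyclic) {S : Set (V ⊕ G.edgeSet)} (hS : _root_.IsIndepSet (subdivision G) S)
    {v : V} (hv : Sum.inl v ∉ S) : S.ncard < Nat.card V := by
  set A : Set V := Sum.inl ⁻¹' S
  set B : Set G.edgeSet := Sum.inr ⁻¹' S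
  have hSAB : S.ncard ≤ A.ncard + B.ncard := by
    rw [← Set.ncard_image_of_injective A (Sum.inl_injective (β := G.edgeSet)),
      ← Set.ncard_image_of_injective B (Sum.inr_injective (α := V))]
    conv_lhs => rw [← Set.image_preimage_inl_union_image_preimage_inr S]
    exact Set.ncard_union_le _ _
  have hsub : Subtype.val '' B ⊆
      Sym2.map Subtype.val '' (G.induce Aᶜ).edgeSet := by
    rintro _ ⟨⟨⟨x, y⟩, he⟩, heB, rfl⟩
    have hnot {w : V} (hw : w ∈ s(x, y)) : w ∈ Aᶜ := fun hwA ↦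
      hS _ hwA _ heB Sum.inl_ne_inr (subdivision_adj_inl_inr.2 hw)
    exact ⟨s(⟨x, hnot (Sym2.mem_mk_left x y)⟩, ⟨y, hnot (Sym2.mem_mk_right x y)⟩), he, rfl⟩
  have hBle : B.ncard ≤ Nat.card (G.induce Aᶜ).edgeSet := by
    rw [← Set.ncard_image_of_injective B Subtype.val_injective]
    exact (Set.ncard_le_ncard hsub (Set.toFinite _)).trans (Set.ncard_image_le (Set.toFinite _))
  have : Nonempty ↥Aᶜ := ⟨⟨v, hv⟩⟩
  have hlt : Nat.card (G.induce Aᶜ).edgeSet < Aᶜ.ncard := (hG.induce Aᶜ).card_edgeSet_lt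
  have hcompl := Set.ncard_add_ncard_compl A
  lia

/-- the subdivision `T` of a tree `T₀` on `q+1` vertices is a tree whose
unique independent set of size `q+1` is `V(T₀)`. -/
theorem subdivision_tree_unique_indepSet {V : Type*} [Fintype V] [DecidableEq V]
    (q : ℕ) (hq : 1 ≤ q) (T₀ : SimpleGraph V) [DecidableRel T₀.Adj]
    (hT₀ : T₀.IsTree) (hcard : Fintype.card V = q + 1) :
    (subdivision T₀).IsTree ∧
      _root_.IsIndepSet (subdivision T₀) (Set.range Sum.inl) ∧
      (Set.range (Sum.inl : V → V ⊕ T₀.edgeSet)).ncard = q + 1 ∧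
      ∀ S : Set (V ⊕ T₀.edgeSet), _root_.IsIndepSet (subdivision T₀) S → S.ncard = q + 1 →
        S = Set.range Sum.inl := by
  have hrange : (Set.range (Sum.inl : V → V ⊕ T₀.edgeSet)).ncard = q + 1 := by
    rw [← Set.image_univ, Set.ncard_image_of_injective _ Sum.inl_injective, Set.ncard_univ,
      Nat.card_eq_fintype_card, hcard]
  refine ⟨isTree_subdivision hT₀, ?_, hrange, fun S hS hScard ↦ ?_⟩
  · rintro _ ⟨v, rfl⟩ _ ⟨w, rfl⟩ -
    exact not_subdivision_adj_inl_inl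
  · refine (Set.eq_of_subset_of_ncard_le ?_ (hScard.trans hrange.symm).le (Set.toFinite S)).symm
    rintro _ ⟨v, rfl⟩
    by_contra hv
    have hlt := ncard_lt_of_isIndepSet_subdivision hT₀.isAcyclic hS hv
    rw [Nat.card_eq_fintype_card, hcard, hScard] at hlt
    exact hlt.false
end
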